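/- arXiv:0901.0536 — 7 statements merged into one kernel-verified Lean document; each statement's English description precedes it below -/
import Mathlib

section
/- Let g_1,…,g_k ∈ GF(2)^ℓ be linearly independent vectors with partial distances D_j = d_H(g_j, ⟨g_{j+1},…,g_k⟩) for 1 ≤ j ≤ k−1 and D_k = d_H(g_k, 0). Then the minimum distance of the linear code ⟨g_1,…,g_k⟩ equals min_{1 ≤ j ≤ k} D_j. -/
/-- Minimum distance of a binary linear code: least Hamming weight of a nonzero
codeword (`0` for the zero code by the `sInf ∅ = 0` convention). -/
noncomputable def minDist {n : ℕ} (C : Submodule (ZMod 2) (Fin n → ZMod 2)) : ℕ :=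
  sInf {d : ℕ | ∃ c ∈ C, c ≠ 0 ∧ d = hammingNorm c}

/-- Partial distance of a finite family of vectors: `D_j` is the Hamming distance
from `g_j` to the span of `g_{j+1}, …, g_k` (for the last index, the span is `{0}`,
so `D_k` is the Hamming weight of `g_k`). -/
noncomputable def famPartialDist {ℓ k : ℕ} (g : Fin k → (Fin ℓ → ZMod 2)) (j : Fin k) : ℕ :=
  sInf {d : ℕ | ∃ c ∈ Submodule.span (ZMod 2) {v : Fin ℓ → ZMod 2 | ∃ j', j < j' ∧ v = g j'},
    d = hammingDist (g j) c}

/-- A nonzero combination of the `g i` equals `g j - c`, where `j` is the least index with nonzero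
coefficient and `c` lies in the span of the later vectors. -/
theorem exists_eq_sub_of_mem_span_range {ℓ k : ℕ} (g : Fin k → (Fin ℓ → ZMod 2))
    {x : Fin ℓ → ZMod 2} (hx : x ∈ Submodule.span (ZMod 2) (Set.range g)) (hx0 : x ≠ 0) :
    ∃ j, ∃ c ∈ Submodule.span (ZMod 2) {v : Fin ℓ → ZMod 2 | ∃ j', j < j' ∧ v = g j'},
      x = g j - c := by
  obtain ⟨a, rfl⟩ := (Submodule.mem_span_range_iff_exists_fun _).1 hx
  have hne : ∃ i, a i ≠ 0 := by
    by_contra! h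
    exact hx0 (by simp [h])
  obtain ⟨j, hj, hmin⟩ := WellFounded.has_min (wellFounded_lt : WellFounded (α := Fin k) (· < ·))
    {i | a i ≠ 0} hne
  have haj : a j = 1 := Fin.eq_one_of_ne_zero (a j) hj
  refine ⟨j, -∑ i ∈ Finset.univ.erase j, a i • g i, Submodule.neg_mem _ ?_, ?_⟩
  · refine Submodule.sum_mem _ fun i hi ↦ ?_
    by_cases hai : a i = 0
    · simp [hai]
    · have hji : j < i :=
        lt_of_le_of_ne (not_lt.1 (hmin i hai)) (Finset.ne_of_mem_erase hi).symm
      exact Submodule.smul_mem _ _ (Submodule.subset_span ⟨i, hji, rfl⟩)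
  · rw [sub_neg_eq_add, ← Finset.add_sum_erase _ _ (Finset.mem_univ j), haj, one_smul]

theorem notMem_span_later {ℓ k : ℕ} {g : Fin k → (Fin ℓ → ZMod 2)}
    (hind : LinearIndependent (ZMod 2) g) (j : Fin k) :
    g j ∉ Submodule.span (ZMod 2) {v : Fin ℓ → ZMod 2 | ∃ j', j < j' ∧ v = g j'} := by
  have hset : {v : Fin ℓ → ZMod 2 | ∃ j', j < j' ∧ v = g j'} = g '' Set.Ioi j := by
    ext v
    simp [eq_comm]
  rw [hset]
  exact hind.notMem_span_image (by simp)

theorem exists_famPartialDist_eq {ℓ k : ℕ} (g : Fin k → (Fin ℓ → ZMod 2)) (j : Fin k) :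
    ∃ c ∈ Submodule.span (ZMod 2) {v : Fin ℓ → ZMod 2 | ∃ j', j < j' ∧ v = g j'},
      famPartialDist g j = hammingDist (g j) c :=
  Nat.sInf_mem (s := {d | ∃ c ∈ Submodule.span (ZMod 2) {v | ∃ j', j < j' ∧ v = g j'},
    d = hammingDist (g j) c}) ⟨_, 0, Submodule.zero_mem _, rfl⟩

theorem exists_minDist_eq {n : ℕ} {C : Submodule (ZMod 2) (Fin n → ZMod 2)} (hC : C ≠ ⊥) :
    ∃ c ∈ C, c ≠ 0 ∧ minDist C = hammingNorm c := by
  obtain ⟨x, hx, hx0⟩ := C.exists_mem_ne_zero_of_ne_bot hC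
  exact Nat.sInf_mem (s := {d | ∃ c ∈ C, c ≠ 0 ∧ d = hammingNorm c}) ⟨_, x, hx, hx0, rfl⟩

/-- Corollary 6: for linearly independent `g_1, …, g_k` with partial distances `D_j`,
the minimum distance of `⟨g_1, …, g_k⟩` equals `min_j D_j`. -/
theorem stmt3 {ℓ k : ℕ} (hk : 0 < k) (g : Fin k → (Fin ℓ → ZMod 2))
    (hind : LinearIndependent (ZMod 2) g) :
    minDist (Submodule.span (ZMod 2) (Set.range g)) = ⨅ j : Fin k, famPartialDist g j := by
  have : Nonempty (Fin k) := ⟨⟨0, hk⟩⟩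
  apply le_antisymm
  · refine le_ciInf fun j ↦ ?_
    obtain ⟨c, hc, hd⟩ := exists_famPartialDist_eq g j
    rw [hd, hammingDist_comm, hammingDist_eq_hammingNorm, neg_add_eq_sub]
    refine Nat.sInf_le ⟨g j - c, Submodule.sub_mem _ (Submodule.subset_span ⟨j, rfl⟩) ?_, ?_, rfl⟩
    · refine Submodule.span_mono ?_ hc
      rintro _ ⟨i, -, rfl⟩
      exact ⟨i, rfl⟩
    · intro h
      exact notMem_span_later hind j (sub_eq_zero.1 h ▸ hc)
  · have hC : Submodule.span (ZMod 2) (Set.range g) ≠ ⊥ := fun h ↦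
      hind.ne_zero ⟨0, hk⟩ (Submodule.span_eq_bot.1 h _ ⟨_, rfl⟩)
    obtain ⟨x, hx, hx0, hd⟩ := exists_minDist_eq hC
    obtain ⟨j, c, hc, rfl⟩ := exists_eq_sub_of_mem_span_range g hx hx0
    rw [hd, ← neg_add_eq_sub, ← hammingDist_eq_hammingNorm, hammingDist_comm]
    exact (ciInf_le (OrderBot.bddBelow _) j).trans (Nat.sInf_le ⟨c, hc, rfl⟩)
end

section
/- Let G be an ℓ×ℓ matrix over GF(2) with rows g_1,…,g_ℓ and partial distances D_1,…,D_ℓ. Fix k ∈ {1,…,ℓ−1} and let G' be the matrix obtained from G by swapping rows g_k and g_{k+1}, with partial distances D'_1,…,D'_ℓ. If D_k > D_{k+1}, then: D'_i = D_i for i ∉ {k, k+1}; D'_k = D_{k+1}; D'_{k+1} ≥ D_k; consequently D'_k · D'_{k+1} ≥ D_k · D_{k+1} (so ∏_{i=1}^ℓ D'_i ≥ ∏_{i=1}^ℓ D_i) and D'_{k+1} > D'_k. -/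
/-- The partial distance `D_i` of the `i`-th row of `G` (0-indexed): the Hamming
distance from row `i` to the GF(2)-linear span of the rows below it. For the last
row the span is `{0}`, so `D_ℓ` is the Hamming weight of the last row. -/
noncomputable def partialDist {ℓ : ℕ} (G : Matrix (Fin ℓ) (Fin ℓ) (ZMod 2)) (i : Fin ℓ) : ℕ :=
  sInf {d : ℕ | ∃ c ∈ Submodule.span (ZMod 2) {v : Fin ℓ → ZMod 2 | ∃ j, i < j ∧ v = G j},
    d = hammingDist (G i) c}

/-- The rows of `G` strictly below row `i`. -/
def rowsBelow {ℓ : ℕ} (G : Matrix (Fin ℓ) (Fin ℓ) (ZMod 2)) (i : Fin ℓ) :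
    Set (Fin ℓ → ZMod 2) :=
  {v | ∃ j, i < j ∧ v = G j}

theorem partialDist_le {ℓ : ℕ} (G : Matrix (Fin ℓ) (Fin ℓ) (ZMod 2)) (i : Fin ℓ)
    {c : Fin ℓ → ZMod 2} (hc : c ∈ Submodule.span (ZMod 2) (rowsBelow G i)) :
    partialDist G i ≤ hammingDist (G i) c :=
  Nat.sInf_le ⟨c, hc, rfl⟩

theorem exists_hammingDist_eq_partialDist {ℓ : ℕ} (G : Matrix (Fin ℓ) (Fin ℓ) (ZMod 2))
    (i : Fin ℓ) :
    ∃ c ∈ Submodule.span (ZMod 2) (rowsBelow G i), partialDist G i = hammingDist (G i) c :=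
  Nat.sInf_mem (s := {d : ℕ | ∃ c ∈ Submodule.span (ZMod 2) (rowsBelow G i),
    d = hammingDist (G i) c}) ⟨_, 0, Submodule.zero_mem _, rfl⟩

theorem partialDist_congr {ℓ : ℕ} {G H : Matrix (Fin ℓ) (Fin ℓ) (ZMod 2)} {i : Fin ℓ}
    (hrow : G i = H i) (hbelow : rowsBelow G i = rowsBelow H i) :
    partialDist G i = partialDist H i := by
  change sInf {d : ℕ | ∃ c ∈ Submodule.span (ZMod 2) (rowsBelow G i), d = hammingDist (G i) c} =
    sInf {d : ℕ | ∃ c ∈ Submodule.span (ZMod 2) (rowsBelow H i), d = hammingDist (H i) c}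
  rw [hrow, hbelow]

/-- Rows below the first of two consecutive rows: the second one and those below it. -/
theorem rowsBelow_eq_insert {ℓ : ℕ} (G : Matrix (Fin ℓ) (Fin ℓ) (ZMod 2)) {a b : Fin ℓ}
    (hab : (a : ℕ) + 1 = (b : ℕ)) : rowsBelow G a = insert (G b) (rowsBelow G b) := by
  ext v
  constructor
  · rintro ⟨j, hj, rfl⟩
    rcases eq_or_ne j b with rfl | hne
    · exact Or.inl rfl
    · exact Or.inr ⟨j, by rw [Ne, Fin.ext_iff] at hne; rw [Fin.lt_def] at *; omega, rfl⟩
  · rintro (rfl | ⟨j, hj, rfl⟩)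
    · exact ⟨b, by rw [Fin.lt_def]; omega, rfl⟩
    · exact ⟨j, by rw [Fin.lt_def] at *; omega, rfl⟩

/-- Permuting rows by `σ` keeps the rows below `i` when `σ` preserves the indices above `i`. -/
theorem rowsBelow_submatrix {ℓ : ℕ} (G : Matrix (Fin ℓ) (Fin ℓ) (ZMod 2))
    (σ : Equiv.Perm (Fin ℓ)) {i : Fin ℓ} (hσ : ∀ j, i < σ j ↔ i < j) :
    rowsBelow (G.submatrix σ id) i = rowsBelow G i := by
  ext v
  constructor
  · rintro ⟨j, hj, rfl⟩
    exact ⟨σ j, (hσ j).2 hj, rfl⟩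
  · rintro ⟨j, hj, rfl⟩
    refine ⟨σ.symm j, (hσ _).1 (by simpa using hj), ?_⟩
    ext k
    simp

theorem lt_swap_iff {ℓ : ℕ} {a b i : Fin ℓ} (h : i < a ↔ i < b) (j : Fin ℓ) :
    i < Equiv.swap a b j ↔ i < j := by
  rw [Equiv.swap_apply_def]
  split_ifs with h₁ h₂
  · rw [h₁, h]
  · rw [h₂, h]
  · rfl

theorem hammingDist_add_left_comm {ι : Type*} [Fintype ι] (x y z : ι → ZMod 2) :
    hammingDist x (y + z) = hammingDist y (x + z) := by
  have key : ∀ p q r : ZMod 2, p ≠ q + r ↔ q ≠ p + r := by decide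
  simp only [hammingDist, Pi.add_apply, key (x _)]

/-- Lemma 7 (partial distances should decrease): if `a` and `b = a+1` are consecutive
row indices of `G` and `D_a > D_b`, then after swapping rows `a` and `b` the partial
distances `D'` satisfy: `D'_i = D_i` off `{a,b}`, `D'_a = D_b`, `D'_b ≥ D_a`, hence
`D'_a · D'_b ≥ D_a · D_b` (so the full product does not decrease) and `D'_b > D'_a`. -/
theorem stmt4 {ℓ : ℕ} (G : Matrix (Fin ℓ) (Fin ℓ) (ZMod 2)) (a b : Fin ℓ)
    (hab : (a : ℕ) + 1 = (b : ℕ))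
    (hD : partialDist G b < partialDist G a) :
    (∀ i, i ≠ a → i ≠ b →
        partialDist (G.submatrix (⇑(Equiv.swap a b)) id) i = partialDist G i) ∧
      partialDist (G.submatrix (⇑(Equiv.swap a b)) id) a = partialDist G b ∧
      partialDist G a ≤ partialDist (G.submatrix (⇑(Equiv.swap a b)) id) b ∧
      partialDist G a * partialDist G b ≤
        partialDist (G.submatrix (⇑(Equiv.swap a b)) id) a *
          partialDist (G.submatrix (⇑(Equiv.swap a b)) id) b ∧
      (∏ i, partialDist G i) ≤ (∏ i, partialDist (G.submatrix (⇑(Equiv.swap a b)) id) i) ∧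
      partialDist (G.submatrix (⇑(Equiv.swap a b)) id) a <
        partialDist (G.submatrix (⇑(Equiv.swap a b)) id) b := by
  set H := G.submatrix (⇑(Equiv.swap a b)) id with hH
  have hHa : H a = G b := by ext k; simp [hH]
  have hHb : H b = G a := by ext k; simp [hH]
  have hlt : a < b := by rw [Fin.lt_def]; omega
  have hbelow : rowsBelow H b = rowsBelow G b :=
    rowsBelow_submatrix G _ (fun j => by
      rw [Equiv.swap_apply_def]
      split_ifs with h₁ h₂
      · simp [h₁, hlt.le]
      · simp [h₂, hlt.le]
      · rfl)
  have hGa := rowsBelow_eq_insert G hab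
  have hHbelow : rowsBelow H a = insert (G a) (rowsBelow G b) := by
    rw [rowsBelow_eq_insert H hab, hHb, hbelow]
  have hoff : ∀ i, i ≠ a → i ≠ b → partialDist H i = partialDist G i := by
    intro i hia hib
    refine partialDist_congr ?_ (rowsBelow_submatrix G _ (lt_swap_iff ?_))
    · ext k
      simp [hH, Equiv.swap_apply_of_ne_of_ne hia hib]
    · rw [Ne, Fin.ext_iff] at hia hib
      rw [Fin.lt_def, Fin.lt_def]
      omega
  have hb : partialDist G a ≤ partialDist H b := by
    obtain ⟨c, hc, hd⟩ := exists_hammingDist_eq_partialDist H b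
    rw [hd, hHb]
    rw [hbelow] at hc
    apply partialDist_le
    rw [hGa]
    exact Submodule.span_mono (Set.subset_insert _ _) hc
  have ha : partialDist H a = partialDist G b := by
    apply le_antisymm
    · obtain ⟨c, hc, hd⟩ := exists_hammingDist_eq_partialDist G b
      rw [hd, ← hHa]
      apply partialDist_le
      rw [hHbelow]
      exact Submodule.span_mono (Set.subset_insert _ _) hc
    · obtain ⟨c, hc, hd⟩ := exists_hammingDist_eq_partialDist H a
      rw [hd, hHa]
      rw [hHbelow, Submodule.mem_span_insert] at hc
      obtain ⟨r, z, hz, rfl⟩ := hc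
      have zero_or_one : ∀ s : ZMod 2, s = 0 ∨ s = 1 := by decide
      rcases zero_or_one r with rfl | rfl
      · rw [zero_smul, zero_add]
        exact partialDist_le G b hz
      · rw [one_smul, hammingDist_add_left_comm]
        refine hD.le.trans (partialDist_le G a ?_)
        rw [hGa]
        exact Submodule.mem_span_insert.2 ⟨1, z, hz, by rw [one_smul]⟩
  have hmul : partialDist G a * partialDist G b ≤ partialDist H a * partialDist H b := by
    rw [ha, mul_comm]
    exact Nat.mul_le_mul_left _ hb
  refine ⟨hoff, ha, hb, hmul, ?_, by omega⟩
  rw [← Finset.prod_mul_prod_compl {a, b} (partialDist G),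
    ← Finset.prod_mul_prod_compl {a, b} (partialDist H),
    Finset.prod_pair hlt.ne, Finset.prod_pair hlt.ne]
  refine Nat.mul_le_mul hmul (Finset.prod_le_prod' fun i hi => ?_)
  simp only [Finset.mem_compl, Finset.mem_insert, Finset.mem_singleton, not_or] at hi
  exact (hoff i hi.1 hi.2).ge
end

section
/- For every ℓ ≥ 2, E_ℓ ≤ (1/ℓ) ∑_{i=1}^ℓ log_ℓ d(ℓ, ℓ−i+1), where d(n,k) denotes the largest possible minimum distance of a binary linear code of length n and dimension k. -/
/-- `d(n,k)`: the largest possible minimum distance of a binary linear code of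
length `n` and dimension `k` (with `sSup ∅ = 0` when no such code exists). -/
noncomputable def maxMinDist (n k : ℕ) : ℕ :=
  sSup {d : ℕ | ∃ C : Submodule (ZMod 2) (Fin n → ZMod 2),
    Module.finrank (ZMod 2) C = k ∧ d = minDist C}

/-- The exponent `E(G) = (1/ℓ) ∑_i log_ℓ D_i`. -/
noncomputable def expE {ℓ : ℕ} (G : Matrix (Fin ℓ) (Fin ℓ) (ZMod 2)) : ℝ :=
  (1 / ℓ : ℝ) * ∑ i, Real.logb ℓ (partialDist G i)

/-- `E_ℓ`: the maximum of `E(G)` over invertible `ℓ×ℓ` matrices over GF(2). -/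
noncomputable def Emax (ℓ : ℕ) : ℝ :=
  sSup {x : ℝ | ∃ G : Matrix (Fin ℓ) (Fin ℓ) (ZMod 2), IsUnit G ∧ x = expE G}

/-- A nonzero combination of rows indexed by `T` has weight at least the partial distance of its
first row. -/
theorem exists_partialDist_le_hammingNorm {ℓ : ℕ} (G : Matrix (Fin ℓ) (Fin ℓ) (ZMod 2))
    (T : Set (Fin ℓ)) {c : Fin ℓ → ZMod 2}
    (hc : c ∈ Submodule.span (ZMod 2) ((fun i => G i) '' T)) (hc0 : c ≠ 0) :
    ∃ i ∈ T, partialDist G i ≤ hammingNorm c := by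
  obtain ⟨f, hfT, rfl⟩ := (Finsupp.mem_span_image_iff_linearCombination _).1 hc
  have hf : f.support.Nonempty := by
    rw [Finsupp.support_nonempty_iff]
    rintro rfl
    simp at hc0
  set i := f.support.min' hf
  have him : i ∈ f.support := f.support.min'_mem hf
  have hfi : f i = 1 := by
    have h2 : ∀ a : ZMod 2, a ≠ 0 → a = 1 := by decide
    exact h2 _ (Finsupp.mem_support_iff.1 him)
  refine ⟨i, hfT him, ?_⟩
  set r : Fin ℓ → ZMod 2 := ∑ j ∈ f.support.erase i, f j • G j
  have hsum : Finsupp.linearCombination (ZMod 2) (fun i => G i) f = G i + r := by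
    rw [Finsupp.linearCombination_apply, Finsupp.sum, ← Finset.add_sum_erase _ _ him, hfi, one_smul]
  refine Nat.sInf_le ⟨-r, ?_, ?_⟩
  · refine Submodule.neg_mem _ (Submodule.sum_mem _ fun j hj => Submodule.smul_mem _ _
      (Submodule.subset_span ⟨j, ?_, rfl⟩))
    obtain ⟨hji, hj⟩ := Finset.mem_erase.1 hj
    exact lt_of_le_of_ne (f.support.min'_le j hj) (Ne.symm hji)
  · rw [hsum, hammingDist_comm, hammingDist_eq_hammingNorm, neg_neg, add_comm]

theorem partialDist_pos {ℓ : ℕ} {G : Matrix (Fin ℓ) (Fin ℓ) (ZMod 2)}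
    (hG : LinearIndependent (ZMod 2) (fun i => G i)) (i : Fin ℓ) : 0 < partialDist G i := by
  obtain ⟨c, hc, hd⟩ := Nat.sInf_mem (s := {d : ℕ | ∃ c ∈ Submodule.span (ZMod 2)
    {v : Fin ℓ → ZMod 2 | ∃ j, i < j ∧ v = G j}, d = hammingDist (G i) c})
    ⟨_, 0, Submodule.zero_mem _, rfl⟩
  change partialDist G i = _ at hd
  rw [hd, hammingDist_pos]
  rintro rfl
  refine hG.notMem_span_image (s := Set.Ioi i) (x := i) (by simp) ?_
  convert hc using 2
  ext v
  simp [eq_comm]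

theorem minDist_le_length {n : ℕ} (C : Submodule (ZMod 2) (Fin n → ZMod 2)) : minDist C ≤ n := by
  rcases Set.eq_empty_or_nonempty {d : ℕ | ∃ c ∈ C, c ≠ 0 ∧ d = hammingNorm c} with h | ⟨d, hd⟩
  · simp [minDist, h]
  · obtain ⟨c, -, -, rfl⟩ := id hd
    exact (Nat.sInf_le hd).trans (hammingNorm_le_card_fintype.trans (by simp))

theorem minDist_le_maxMinDist {n : ℕ} (C : Submodule (ZMod 2) (Fin n → ZMod 2)) :
    minDist C ≤ maxMinDist n (Module.finrank (ZMod 2) C) := by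
  refine le_csSup ⟨n, ?_⟩ ⟨C, rfl, rfl⟩
  rintro _ ⟨C', -, rfl⟩
  exact minDist_le_length C'

/-- Rows whose partial distances are all at least `t` span a code of minimum distance at least
`t`. -/
theorem le_maxMinDist_card {ℓ : ℕ} {G : Matrix (Fin ℓ) (Fin ℓ) (ZMod 2)}
    (hG : LinearIndependent (ZMod 2) (fun i => G i)) {T : Finset (Fin ℓ)} (hT : T.Nonempty) {t : ℕ}
    (ht : ∀ i ∈ T, t ≤ partialDist G i) : t ≤ maxMinDist ℓ T.card := by
  set C := Submodule.span (ZMod 2) ((fun i => G i) '' (T : Set (Fin ℓ))) with hC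
  have hrank : Module.finrank (ZMod 2) C = T.card := by
    have h := finrank_span_eq_card (hG.comp (fun i : T => (i : Fin ℓ)) Subtype.val_injective)
    rw [Fintype.card_coe] at h
    have himage : (fun i => G i) '' (T : Set (Fin ℓ)) =
        Set.range ((fun i => G i) ∘ fun i : T => (i : Fin ℓ)) := by
      rw [Set.range_comp]
      congr 1
      ext
      simp
    rw [← h, hC, himage]
  rw [← hrank]
  refine le_trans ?_ (minDist_le_maxMinDist C)
  obtain ⟨i, hi⟩ := hT
  refine le_csInf ⟨_, G i, Submodule.subset_span ⟨i, hi, rfl⟩, hG.ne_zero i, rfl⟩ ?_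
  rintro _ ⟨c, hc, hc0, rfl⟩
  obtain ⟨j, hj, hjc⟩ := exists_partialDist_le_hammingNorm G _ hc hc0
  exact (ht j hj).trans hjc


/-- Lemma 11 (upper bound on exponent):
`E_ℓ ≤ (1/ℓ) ∑_{i=1}^ℓ log_ℓ d(ℓ, ℓ-i+1)` (0-indexed: dimension `ℓ - i.val`). -/
theorem stmt8 (ℓ : ℕ) (hℓ : 2 ≤ ℓ) :
    Emax ℓ ≤ (1 / ℓ : ℝ) * ∑ i : Fin ℓ, Real.logb ℓ (maxMinDist ℓ (ℓ - i.val)) := by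
  refine csSup_le ⟨_, 1, isUnit_one, rfl⟩ ?_
  rintro _ ⟨G, hG, rfl⟩
  have hlin : LinearIndependent (ZMod 2) (fun i => G i) :=
    Matrix.linearIndependent_rows_iff_isUnit.2 hG
  let σ := Tuple.sort (partialDist G)
  rw [expE, ← Equiv.sum_comp σ]
  refine mul_le_mul_of_nonneg_left (Finset.sum_le_sum fun k _ => ?_) (by positivity)
  have hpos : 0 < partialDist G (σ k) := partialDist_pos hlin _
  have hle : partialDist G (σ k) ≤ maxMinDist ℓ (ℓ - k.val) := by
    have hcard : ((Finset.Ici k).map σ.toEmbedding).card = ℓ - k.val := by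
      rw [Finset.card_map, Fin.card_Ici]
    rw [← hcard]
    refine le_maxMinDist_card hlin (Finset.Nonempty.map ⟨k, Finset.mem_Ici.2 le_rfl⟩) fun i hi => ?_
    obtain ⟨j, hj, rfl⟩ := Finset.mem_map.1 hi
    exact Tuple.monotone_sort (partialDist G) (Finset.mem_Ici.1 hj)
  exact Real.logb_le_logb_of_le (by exact_mod_cast hℓ) (by exact_mod_cast hpos)
    (by exact_mod_cast hle)
end

section
/- Let ℓ ≥ 2 and let G be an invertible ℓ×ℓ matrix over GF(2) with rows g_1,…,g_ℓ whose partial distances satisfy D_1 ≤ D_2 ≤ ⋯ ≤ D_ℓ. Fix a column index j, let i be the largest row index with G_{i,j} = 1, and let G' be the (ℓ−1)×(ℓ−1) matrix whose rows, in their original order, are obtained from the rows g_k with k ≠ i by replacing g_k with g_k + g_i whenever G_{k,j} = 1 and then deleting coordinate j. Let D'_1,…,D'_{ℓ−1} be the partial distances of G'. Then D'_k ≥ D_k for 1 ≤ k ≤ i−1, and D'_k = D_{k+1} for i ≤ k ≤ ℓ−1. -/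
theorem partialDist_le_hammingDist {ℓ : ℕ} (G : Matrix (Fin ℓ) (Fin ℓ) (ZMod 2)) (i : Fin ℓ)
    {c : Fin ℓ → ZMod 2}
    (hc : c ∈ Submodule.span (ZMod 2) {v : Fin ℓ → ZMod 2 | ∃ j, i < j ∧ v = G j}) :
    partialDist G i ≤ hammingDist (G i) c :=
  Nat.sInf_le ⟨c, hc, rfl⟩

theorem exists_partialDist_eq_hammingDist {ℓ : ℕ} (G : Matrix (Fin ℓ) (Fin ℓ) (ZMod 2))
    (i : Fin ℓ) :
    ∃ c ∈ Submodule.span (ZMod 2) {v : Fin ℓ → ZMod 2 | ∃ j, i < j ∧ v = G j},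
      partialDist G i = hammingDist (G i) c :=
  Nat.sInf_mem (s := {d : ℕ | ∃ c ∈ Submodule.span (ZMod 2)
    {v : Fin ℓ → ZMod 2 | ∃ j, i < j ∧ v = G j}, d = hammingDist (G i) c})
    ⟨_, 0, Submodule.zero_mem _, rfl⟩

/-- Insert a zero coordinate at position `j`. -/
def insertZero {m : ℕ} (j : Fin (m + 1)) : (Fin m → ZMod 2) →ₗ[ZMod 2] (Fin (m + 1) → ZMod 2) where
  toFun w := j.insertNth (0 : ZMod 2) w
  map_add' x y := by
    ext c
    induction c using j.succAboveCases <;> simp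
  map_smul' a x := by
    ext c
    induction c using j.succAboveCases <;> simp

@[simp]
theorem insertZero_apply_same {m : ℕ} (j : Fin (m + 1)) (w : Fin m → ZMod 2) :
    insertZero j w j = 0 := by
  simp [insertZero]

@[simp]
theorem insertZero_apply_succAbove {m : ℕ} (j : Fin (m + 1)) (w : Fin m → ZMod 2) (c : Fin m) :
    insertZero j w (j.succAbove c) = w c := by
  simp [insertZero]

theorem hammingDist_insertZero {m : ℕ} (j : Fin (m + 1)) (x y : Fin m → ZMod 2) :
    hammingDist (insertZero j x) (insertZero j y) = hammingDist x y := by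
  simp only [hammingDist, Finset.card_filter, Fin.sum_univ_succAbove _ j,
    insertZero_apply_same, insertZero_apply_succAbove]
  simp

/-- Lemma 15 (partial distances after shortening). Here the matrix size is
`ℓ = m + 1` with `m ≥ 1` (so `ℓ ≥ 2`). `G` is invertible with nondecreasing partial
distances, `j` is a column, and `i` is the largest row index with `G i j = 1`.
The shortened `(ℓ-1)×(ℓ-1)` matrix `G'` keeps the rows `g_k`, `k ≠ i`, in their
original order (`Fin.succAbove i` enumerates them), replaces `g_k` by `g_k + g_i`
whenever `G k j = 1`, and deletes column `j` (`Fin.succAbove j` enumerates the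
remaining columns). Then `D'_k ≥ D_k` for the rows before row `i`, and
`D'_k = D_{k+1}` for the rows after it. -/
theorem stmt11 {m : ℕ} (hm : 1 ≤ m) (G : Matrix (Fin (m + 1)) (Fin (m + 1)) (ZMod 2))
    (hG : IsUnit G)
    (hmono : ∀ a b : Fin (m + 1), a ≤ b → partialDist G a ≤ partialDist G b)
    (i j : Fin (m + 1)) (hij : G i j = 1) (hlast : ∀ k, i < k → G k j = 0)
    (G' : Matrix (Fin m) (Fin m) (ZMod 2))
    (hG' : ∀ k c, G' k c =
      if G (i.succAbove k) j = 1
      then G (i.succAbove k) (j.succAbove c) + G i (j.succAbove c)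
      else G (i.succAbove k) (j.succAbove c)) :
    ∀ k : Fin m,
      ((k : ℕ) < (i : ℕ) → partialDist G k.castSucc ≤ partialDist G' k) ∧
      ((i : ℕ) ≤ (k : ℕ) → partialDist G' k = partialDist G k.succ) := by
  have hrow : ∀ k, insertZero j (G' k) =
      G (i.succAbove k) + if G (i.succAbove k) j = 1 then G i else 0 := by
    intro k
    ext c
    induction c using j.succAboveCases with
    | x =>
      rw [insertZero_apply_same]
      split_ifs with h
      · rw [Pi.add_apply, h, hij]; decide
      · have : ∀ a : ZMod 2, a ≠ 1 → a = 0 := by decide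
        simp [this _ h]
    | p c =>
      rw [insertZero_apply_succAbove, hG']
      split_ifs <;> simp
  have hrow_ge : ∀ k : Fin m, (i : ℕ) ≤ k → insertZero j (G' k) = G k.succ := by
    intro k hk
    have hs : i.succAbove k = k.succ := Fin.succAbove_of_le_castSucc _ _ hk
    have h0 := hlast k.succ (Fin.lt_def.2 (by simp; omega))
    rw [hrow, hs, h0]
    simp
  intro k
  refine ⟨fun hk => ?_, fun hk => ?_⟩
  · have hs : i.succAbove k = k.castSucc := Fin.succAbove_of_castSucc_lt _ _ hk
    set S := Submodule.span (ZMod 2) {v | ∃ l, k.castSucc < l ∧ v = G l}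
    have hmem : ∀ l, k.castSucc < l → G l ∈ S := fun l hl => Submodule.subset_span ⟨l, hl, rfl⟩
    have hmem_ite : ∀ l, (if G l j = 1 then G i else 0) ∈ S := by
      intro l
      split_ifs
      · exact hmem i hk
      · exact S.zero_mem
    obtain ⟨c, hc, hd⟩ := exists_partialDist_eq_hammingDist G' k
    have hc' : insertZero j c ∈ S := by
      suffices h : Submodule.span (ZMod 2) {v | ∃ l, k < l ∧ v = G' l} ≤
          S.comap (insertZero j) from h hc
      refine Submodule.span_le.2 ?_
      rintro _ ⟨l, hl, rfl⟩
      change insertZero j (G' l) ∈ S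
      rw [hrow]
      refine S.add_mem (hmem _ ?_) (hmem_ite _)
      rw [← hs]
      exact Fin.strictMono_succAbove i hl
    refine (partialDist_le_hammingDist G k.castSucc (S.sub_mem hc' (hmem_ite k.castSucc))).trans
      (le_of_eq ?_)
    rw [hd, ← hammingDist_insertZero j, hrow, hs, hammingDist_eq_hammingNorm,
      hammingDist_eq_hammingNorm]
    congr 1
    abel
  · have hspan : Submodule.span (ZMod 2) {v | ∃ l, k.succ < l ∧ v = G l} =
        (Submodule.span (ZMod 2) {v | ∃ l, k < l ∧ v = G' l}).map (insertZero j) := by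
      rw [Submodule.map_span]
      congr 1
      ext v
      constructor
      · rintro ⟨l, hl, rfl⟩
        obtain ⟨l, rfl⟩ := Fin.exists_succ_eq.2 (Fin.ne_zero_of_lt hl)
        have hl' := Fin.succ_lt_succ_iff.1 hl
        exact ⟨G' l, ⟨l, hl', rfl⟩, hrow_ge l (hk.trans hl'.le)⟩
      · rintro ⟨_, ⟨l, hl, rfl⟩, rfl⟩
        exact ⟨l.succ, Fin.succ_lt_succ_iff.2 hl, hrow_ge l (hk.trans (Fin.lt_def.1 hl).le)⟩
    refine le_antisymm ?_ ?_
    · obtain ⟨c, hc, hd⟩ := exists_partialDist_eq_hammingDist G k.succ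
      rw [hspan] at hc
      obtain ⟨c, hc, rfl⟩ := hc
      rw [hd, ← hrow_ge k hk, hammingDist_insertZero]
      exact partialDist_le_hammingDist G' k hc
    · obtain ⟨c, hc, hd⟩ := exists_partialDist_eq_hammingDist G' k
      rw [hd, ← hammingDist_insertZero j, hrow_ge k hk]
      exact partialDist_le_hammingDist G k.succ (hspan ▸ Submodule.mem_map_of_mem hc)
end

section
/- For every δ > 0 there exists η > 0 such that for every finite output alphabet 𝒴, every symmetric B-DMC W on 𝒴 with δ < I(W) < 1 − δ, and every k ≥ 2, it holds that I(W^k) − I(W) > η. -/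
/-- A binary-input discrete memoryless channel on finite alphabet `Y`:
nonnegative transition probabilities summing to one for each input. -/
def IsBDMC {Y : Type} [Fintype Y] (W : ZMod 2 → Y → ℝ) : Prop :=
  (∀ b y, 0 ≤ W b y) ∧ (∀ b, ∑ y, W b y = 1)

/-- A B-DMC is symmetric if there is an involutive permutation `π` of the output
alphabet with `W(y|0) = W(π y|1)` for all `y`. -/
def IsSymmetricBDMC {Y : Type} [Fintype Y] (W : ZMod 2 → Y → ℝ) : Prop :=
  ∃ π : Equiv.Perm Y, (∀ y, π (π y) = y) ∧ (∀ y, W 0 y = W 1 (π y))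

/-- The Bhattacharyya parameter `Z(W) = ∑_y √(W(y|0)W(y|1))`. -/
noncomputable def chanZ {Y : Type} [Fintype Y] (W : ZMod 2 → Y → ℝ) : ℝ :=
  ∑ y, Real.sqrt (W 0 y * W 1 y)

/-- The symmetric mutual information
`I(W) = ∑_{b,y} (1/2) W(y|b) log₂(W(y|b) / ((W(y|0)+W(y|1))/2))` (with `0·log 0 = 0`,
which holds automatically since `Real.logb` of junk is multiplied by `0`). -/
noncomputable def chanI {Y : Type} [Fintype Y] (W : ZMod 2 → Y → ℝ) : ℝ :=
  ∑ b : ZMod 2, ∑ y, (1/2) * W b y * Real.logb 2 (W b y / ((W 0 y + W 1 y) / 2))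

open Real

/-- Capacity in nats of a binary symmetric channel with bias `s`, i.e. crossover
probability `(1 - s) / 2`. -/
noncomputable def bscCapacity (s : ℝ) : ℝ := log 2 - binEntropy ((1 + s) / 2)

lemma mul_log_half {x : ℝ} : x / 2 * log (x / 2) = (x * log x - x * log 2) / 2 := by
  rcases eq_or_ne x 0 with rfl | hx
  · simp
  · rw [log_div hx two_ne_zero]; ring

lemma bscCapacity_eq (s : ℝ) :
    bscCapacity s = ((1 + s) * log (1 + s) + (1 - s) * log (1 - s)) / 2 := by
  have h₁ := mul_log_half (x := 1 + s)
  have h₂ := mul_log_half (x := 1 - s)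
  have h₃ : 1 - (1 + s) / 2 = (1 - s) / 2 := by ring
  rw [bscCapacity, binEntropy, h₃, log_inv, log_inv]
  linarith

lemma bscCapacity_neg (s : ℝ) : bscCapacity (-s) = bscCapacity s := by
  simp only [bscCapacity_eq, sub_neg_eq_add, ← sub_eq_add_neg]
  ring

lemma bscCapacity_abs (s : ℝ) : bscCapacity |s| = bscCapacity s := by
  rcases abs_choice s with h | h <;> simp [h, bscCapacity_neg]

lemma bscCapacity_one : bscCapacity 1 = log 2 := by simp [bscCapacity]

lemma bscCapacity_nonneg (s : ℝ) : 0 ≤ bscCapacity s := by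
  have := binEntropy_le_log_two (p := (1 + s) / 2)
  unfold bscCapacity
  linarith

lemma continuous_bscCapacity : Continuous bscCapacity := by
  unfold bscCapacity
  fun_prop

lemma bscCapacity_mul_le_of_nonneg {s t : ℝ} (hs : |s| ≤ 1) (ht₀ : 0 ≤ t) (ht₁ : t ≤ 1) :
    bscCapacity (t * s) ≤ t * bscCapacity s := by
  obtain ⟨h₁, h₂⟩ := abs_le.mp hs
  have h := strictConcave_binEntropy.concaveOn.2
    (x := (1 + s) / 2) (y := 1 / 2) ⟨by linarith, by linarith⟩ ⟨by norm_num, by norm_num⟩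
    ht₀ (sub_nonneg.mpr ht₁) (by ring)
  have h₃ : t • ((1 + s) / 2) + (1 - t) • (1 / 2 : ℝ) = (1 + t * s) / 2 := by
    simp only [smul_eq_mul]; ring
  have h₄ : binEntropy (1 / 2) = log 2 := by rw [one_div, binEntropy_two_inv]
  rw [h₃, h₄, smul_eq_mul, smul_eq_mul] at h
  unfold bscCapacity
  linarith

lemma bscCapacity_mul_le {s t : ℝ} (hs : |s| ≤ 1) (ht : |t| ≤ 1) :
    bscCapacity (s * t) ≤ bscCapacity s * |t| := by
  have h := bscCapacity_mul_le_of_nonneg (s := |s|) (by rwa [abs_abs]) (abs_nonneg t) ht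
  rwa [← abs_mul, bscCapacity_abs, bscCapacity_abs, mul_comm t, mul_comm |t|] at h

/-- Near full bias the capacity is close to `log 2`; away from it `1 - |s|` is bounded below. -/
lemma exists_log_two_sub_bscCapacity_le {ε : ℝ} (hε : 0 < ε) :
    ∃ C : ℝ, 0 < C ∧ ∀ s : ℝ, |s| ≤ 1 → log 2 - bscCapacity s ≤ ε + C * (1 - |s|) := by
  obtain ⟨r, hr, h⟩ := Metric.continuousAt_iff.mp
    (continuous_bscCapacity.continuousAt (x := 1)) ε hε
  have hlog : 0 < log 2 := log_pos one_lt_two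
  refine ⟨log 2 / r, by positivity, fun s hs => ?_⟩
  have hs' : 0 ≤ 1 - |s| := by linarith
  rcases lt_or_ge (1 - |s|) r with hlt | hge
  · have h₁ := h (x := |s|) (by rw [Real.dist_eq, abs_sub_comm, abs_of_nonneg hs']; exact hlt)
    rw [Real.dist_eq, bscCapacity_abs, bscCapacity_one, abs_sub_comm] at h₁
    have h₂ := le_abs_self (log 2 - bscCapacity s)
    have : 0 ≤ log 2 / r * (1 - |s|) := by positivity
    linarith
  · have h₁ : log 2 ≤ log 2 / r * (1 - |s|) := by
      rw [div_mul_eq_mul_div, le_div_iff₀ hr]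
      gcongr
    have := bscCapacity_nonneg s
    linarith

section Channel

variable {Y Z : Type} [Fintype Y] [Fintype Z]

/-- The output distribution under uniform input. -/
noncomputable def chanMean {Y : Type} (W : ZMod 2 → Y → ℝ) (y : Y) : ℝ := (W 0 y + W 1 y) / 2

/-- The difference of the posterior probabilities of the two inputs given the output `y`. -/
noncomputable def chanBias {Y : Type} (W : ZMod 2 → Y → ℝ) (y : Y) : ℝ :=
  (W 0 y - W 1 y) / (W 0 y + W 1 y)

lemma chanMean_mul_chanBias {W : ZMod 2 → Y → ℝ} (hW : IsBDMC W) (y : Y) :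
    chanMean W y * chanBias W y = (W 0 y - W 1 y) / 2 := by
  have h₀ := hW.1 0 y
  have h₁ := hW.1 1 y
  unfold chanMean chanBias
  rcases eq_or_ne (W 0 y + W 1 y) 0 with h | h
  · have e₀ : W 0 y = 0 := by linarith
    have e₁ : W 1 y = 0 := by linarith
    simp [e₀, e₁]
  · field_simp

lemma chan_zero_eq {W : ZMod 2 → Y → ℝ} (hW : IsBDMC W) (y : Y) :
    W 0 y = chanMean W y * (1 + chanBias W y) := by
  rw [mul_add, chanMean_mul_chanBias hW, chanMean]; ring

lemma chan_one_eq {W : ZMod 2 → Y → ℝ} (hW : IsBDMC W) (y : Y) :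
    W 1 y = chanMean W y * (1 - chanBias W y) := by
  rw [mul_sub, chanMean_mul_chanBias hW, chanMean]; ring

lemma chanMean_nonneg {W : ZMod 2 → Y → ℝ} (hW : IsBDMC W) (y : Y) : 0 ≤ chanMean W y := by
  have h₀ := hW.1 0 y
  have h₁ := hW.1 1 y
  unfold chanMean
  positivity

lemma abs_chanBias_le_one {W : ZMod 2 → Y → ℝ} (hW : IsBDMC W) (y : Y) :
    |chanBias W y| ≤ 1 := by
  have h₀ := hW.1 0 y
  have h₁ := hW.1 1 y
  rw [chanBias, abs_div, abs_of_nonneg (add_nonneg h₀ h₁)]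
  refine div_le_one_of_le₀ (abs_le.mpr ⟨?_, ?_⟩) (by positivity) <;> linarith

lemma sum_chanMean {W : ZMod 2 → Y → ℝ} (hW : IsBDMC W) : ∑ y, chanMean W y = 1 := by
  simp only [chanMean, ← Finset.sum_div, Finset.sum_add_distrib, hW.2]
  norm_num

lemma sum_chanMean_mul_chanBias {W : ZMod 2 → Y → ℝ} (hW : IsBDMC W) :
    ∑ y, chanMean W y * chanBias W y = 0 := by
  simp only [chanMean_mul_chanBias hW, ← Finset.sum_div, Finset.sum_sub_distrib, hW.2]
  norm_num

lemma chanI_eq_sum (W : ZMod 2 → Y → ℝ) :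
    chanI W = ∑ y, ((1 / 2) * W 0 y * logb 2 (W 0 y / chanMean W y) +
      (1 / 2) * W 1 y * logb 2 (W 1 y / chanMean W y)) := by
  rw [Finset.sum_add_distrib]
  exact Fin.sum_univ_two (fun b : Fin 2 =>
    ∑ y, (1 / 2) * W b y * logb 2 (W b y / ((W 0 y + W 1 y) / 2)))

lemma chanI_mul_log_two {W : ZMod 2 → Y → ℝ} (hW : IsBDMC W) :
    chanI W * log 2 = ∑ y, chanMean W y * bscCapacity (chanBias W y) := by
  have hlog : log 2 ≠ 0 := (log_pos one_lt_two).ne'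
  rw [chanI_eq_sum, Finset.sum_mul]
  refine Finset.sum_congr rfl fun y _ => ?_
  rw [bscCapacity_eq, chan_zero_eq hW y, chan_one_eq hW y]
  rcases eq_or_ne (chanMean W y) 0 with h | h
  · simp [h]
  · rw [mul_div_cancel_left₀ _ h, mul_div_cancel_left₀ _ h, logb, logb]
    field_simp

lemma chanMean_mul_bscCapacity_chanBias {W : ZMod 2 → Y → ℝ} (hW : IsBDMC W) (y : Y) :
    chanMean W y * bscCapacity (chanBias W y) =
      negMulLog (chanMean W y) - (negMulLog (W 0 y) + negMulLog (W 1 y)) / 2 := by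
  rw [bscCapacity_eq, chan_zero_eq hW y, chan_one_eq hW y, negMulLog_mul, negMulLog_mul]
  simp only [negMulLog]
  ring

lemma chanI_mul_log_two_eq_negMulLog {W : ZMod 2 → Y → ℝ} (hW : IsBDMC W) :
    chanI W * log 2 =
      ∑ y, (negMulLog (chanMean W y) - (negMulLog (W 0 y) + negMulLog (W 1 y)) / 2) := by
  rw [chanI_mul_log_two hW]
  exact Finset.sum_congr rfl fun y _ => chanMean_mul_bscCapacity_chanBias hW y

lemma chanI_comp_equiv (e : Z ≃ Y) (W : ZMod 2 → Y → ℝ) :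
    chanI (fun b z => W b (e z)) = chanI W := by
  unfold chanI
  exact Finset.sum_congr rfl fun b _ => e.sum_comp
    (fun y => (1 / 2) * W b y * logb 2 (W b y / ((W 0 y + W 1 y) / 2)))

/-- The channel transmitting the same bit independently through `W` and `V`. -/
def chanProd {Y Z : Type} (W : ZMod 2 → Y → ℝ) (V : ZMod 2 → Z → ℝ) : ZMod 2 → Y × Z → ℝ :=
  fun b p => W b p.1 * V b p.2

lemma IsBDMC.chanProd {W : ZMod 2 → Y → ℝ} {V : ZMod 2 → Z → ℝ} (hW : IsBDMC W)
    (hV : IsBDMC V) : IsBDMC (chanProd W V) := by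
  refine ⟨fun b p => mul_nonneg (hW.1 b _) (hV.1 b _), fun b => ?_⟩
  simp only [_root_.chanProd]
  rw [Fintype.sum_prod_type, ← Finset.sum_mul_sum, hW.2, hV.2, one_mul]

lemma IsBDMC.pow {W : ZMod 2 → Y → ℝ} (hW : IsBDMC W) (k : ℕ) :
    IsBDMC (fun b (y : Fin k → Y) => ∏ t, W b (y t)) := by
  refine ⟨fun b y => Finset.prod_nonneg fun t _ => hW.1 b _, fun b => ?_⟩
  have h := Finset.prod_univ_sum (fun _ : Fin k => (Finset.univ : Finset Y)) (fun _ y => W b y)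
  rw [Fintype.piFinset_univ] at h
  rw [← h]
  simp [hW.2]

lemma chanI_chanProd {W : ZMod 2 → Y → ℝ} {V : ZMod 2 → Z → ℝ} (hW : IsBDMC W)
    (hV : IsBDMC V) :
    chanI (chanProd W V) * log 2 = chanI W * log 2 + chanI V * log 2 +
      ∑ z, ∑ y, chanMean W y * chanMean V z * negMulLog (1 + chanBias W y * chanBias V z) := by
  have hterm (y : Y) (z : Z) :
      negMulLog (chanMean (chanProd W V) (y, z)) -
          (negMulLog (chanProd W V 0 (y, z)) + negMulLog (chanProd W V 1 (y, z))) / 2 =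
        chanMean W y * chanMean V z * negMulLog (1 + chanBias W y * chanBias V z) +
        (chanMean W y * negMulLog (chanMean V z) + chanMean V z * negMulLog (chanMean W y) +
        ((chanMean W y * chanBias W y) * (chanBias V z * negMulLog (chanMean V z)) +
          (chanMean V z * chanBias V z) * (chanBias W y * negMulLog (chanMean W y)))) -
        (V 0 z * negMulLog (W 0 y) + W 0 y * negMulLog (V 0 z) +
          (V 1 z * negMulLog (W 1 y) + W 1 y * negMulLog (V 1 z))) / 2 := by
    have hq : chanMean (chanProd W V) (y, z) =
        chanMean W y * chanMean V z * (1 + chanBias W y * chanBias V z) := by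
      rw [chanMean, chanProd, chanProd, chan_zero_eq hW, chan_zero_eq hV, chan_one_eq hW,
        chan_one_eq hV]
      ring
    rw [hq]
    simp only [chanProd, negMulLog_mul]
    ring
  rw [chanI_mul_log_two_eq_negMulLog (hW.chanProd hV), chanI_mul_log_two_eq_negMulLog hW,
    chanI_mul_log_two_eq_negMulLog hV, Fintype.sum_prod_type_right]
  simp only [hterm, Finset.sum_add_distrib, Finset.sum_sub_distrib, ← Finset.sum_div,
    ← Finset.mul_sum, ← Finset.sum_mul, sum_chanMean hW, sum_chanMean hV,
    sum_chanMean_mul_chanBias hW, sum_chanMean_mul_chanBias hV, hW.2, hV.2]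
  ring

lemma sum_negMulLog_one_add_of_symmetric {W : ZMod 2 → Y → ℝ} (hS : IsSymmetricBDMC W)
    (t : ℝ) :
    ∑ y, chanMean W y * negMulLog (1 + chanBias W y * t) =
      -∑ y, chanMean W y * bscCapacity (chanBias W y * t) := by
  obtain ⟨σ, hinv, hσ⟩ := hS
  have hσ' (y : Y) : W 0 (σ y) = W 1 y := by rw [hσ, hinv]
  have hmean (y : Y) : chanMean W (σ y) = chanMean W y := by
    rw [chanMean, chanMean, hσ', ← hσ, add_comm]
  have hbias (y : Y) : chanBias W (σ y) = -chanBias W y := by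
    rw [chanBias, chanBias, hσ', ← hσ, add_comm, ← neg_div, neg_sub]
  have hswap : ∑ y, chanMean W y * negMulLog (1 + chanBias W y * t) =
      ∑ y, chanMean W y * negMulLog (1 - chanBias W y * t) := by
    rw [← Equiv.sum_comp σ]
    simp only [hmean, hbias, neg_mul, ← sub_eq_add_neg]
  have hcap : ∑ y, chanMean W y * bscCapacity (chanBias W y * t) =
      -(∑ y, chanMean W y * negMulLog (1 + chanBias W y * t) +
        ∑ y, chanMean W y * negMulLog (1 - chanBias W y * t)) / 2 := by
    rw [← Finset.sum_add_distrib, ← Finset.sum_neg_distrib, Finset.sum_div]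
    refine Finset.sum_congr rfl fun y _ => ?_
    rw [bscCapacity_eq, negMulLog, negMulLog]
    ring
  rw [hcap, ← hswap]
  ring

/-- The mean absolute bias, i.e. the total variation distance between the two output laws. -/
noncomputable def chanAbsBias (W : ZMod 2 → Y → ℝ) : ℝ := ∑ y, chanMean W y * |chanBias W y|

lemma chanAbsBias_le_one {W : ZMod 2 → Y → ℝ} (hW : IsBDMC W) : chanAbsBias W ≤ 1 := by
  rw [← sum_chanMean hW]
  exact Finset.sum_le_sum fun y _ =>
    mul_le_of_le_one_right (chanMean_nonneg hW y) (abs_chanBias_le_one hW y)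

/-- Adding an independent observation through a symmetric channel increases the mutual
information at least by the uncertainty left by the other channel. -/
lemma chanI_mul_le_chanI_chanProd_sub {W : ZMod 2 → Y → ℝ} {V : ZMod 2 → Z → ℝ}
    (hW : IsBDMC W) (hS : IsSymmetricBDMC W) (hV : IsBDMC V) :
    chanI W * (1 - chanAbsBias V) ≤ chanI (chanProd W V) - chanI V := by
  have hlog : 0 < log 2 := log_pos one_lt_two
  have hcross : -∑ z, ∑ y, chanMean W y * chanMean V z *
      negMulLog (1 + chanBias W y * chanBias V z) ≤ chanI W * log 2 * chanAbsBias V := by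
    have hpull (z : Z) : ∑ y, chanMean W y * chanMean V z *
        negMulLog (1 + chanBias W y * chanBias V z) =
        -(chanMean V z * ∑ y, chanMean W y * bscCapacity (chanBias W y * chanBias V z)) := by
      rw [← mul_neg, ← sum_negMulLog_one_add_of_symmetric hS, Finset.mul_sum]
      exact Finset.sum_congr rfl fun y _ => by ring
    simp only [hpull, Finset.sum_neg_distrib, neg_neg]
    rw [chanI_mul_log_two hW, chanAbsBias, Finset.mul_sum]
    refine Finset.sum_le_sum fun z _ => ?_
    rw [mul_left_comm, Finset.sum_mul]
    refine mul_le_mul_of_nonneg_left (Finset.sum_le_sum fun y _ => ?_) (chanMean_nonneg hV z)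
    rw [mul_assoc]
    exact mul_le_mul_of_nonneg_left
      (bscCapacity_mul_le (abs_chanBias_le_one hW y) (abs_chanBias_le_one hV z))
      (chanMean_nonneg hW y)
  have hprod := chanI_chanProd hW hV
  refine le_of_mul_le_mul_right ?_ hlog
  linarith

lemma chanI_pow_succ (W : ZMod 2 → Y → ℝ) (k : ℕ) :
    chanI (fun b (y : Fin (k + 1) → Y) => ∏ t, W b (y t)) =
      chanI (chanProd W fun b (y : Fin k → Y) => ∏ t, W b (y t)) := by
  rw [← chanI_comp_equiv (Fin.consEquiv fun _ : Fin (k + 1) => Y)]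
  simp only [Fin.prod_univ_succ, Fin.consEquiv, Equiv.coe_fn_mk, Fin.cons_zero, Fin.cons_succ]
  rfl

lemma chanI_pow_one (W : ZMod 2 → Y → ℝ) :
    chanI (fun b (y : Fin 1 → Y) => ∏ t, W b (y t)) = chanI W := by
  rw [← chanI_comp_equiv (Equiv.funUnique (Fin 1) Y) W]
  simp

/-- A lower bound on the residual uncertainty in terms of the mutual information. -/
lemma log_two_mul_one_sub_chanI_le {W : ZMod 2 → Y → ℝ} (hW : IsBDMC W) {ε C : ℝ}
    (hC : ∀ s : ℝ, |s| ≤ 1 → log 2 - bscCapacity s ≤ ε + C * (1 - |s|)) :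
    (1 - chanI W) * log 2 ≤ ε + C * (1 - chanAbsBias W) := by
  have h := Finset.sum_le_sum fun y (_ : y ∈ Finset.univ) =>
    mul_le_mul_of_nonneg_left (hC _ (abs_chanBias_le_one hW y)) (chanMean_nonneg hW y)
  have hl : ∑ y, chanMean W y * (log 2 - bscCapacity (chanBias W y)) =
      (1 - chanI W) * log 2 := by
    simp only [mul_sub, Finset.sum_sub_distrib, ← Finset.sum_mul, sum_chanMean hW,
      ← chanI_mul_log_two hW]
    ring
  have hr : ∑ y, chanMean W y * (ε + C * (1 - |chanBias W y|)) =
      ε + C * (1 - chanAbsBias W) := by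
    have (y : Y) : chanMean W y * (ε + C * (1 - |chanBias W y|)) =
        chanMean W y * (ε + C) - C * (chanMean W y * |chanBias W y|) := by ring
    simp only [this, Finset.sum_sub_distrib, ← Finset.sum_mul, ← Finset.mul_sum,
      sum_chanMean hW, chanAbsBias]
    ring
  rwa [hl, hr] at h

end Channel

/-- Lemma 19 (mutual information of `W^k`): for every `δ > 0` there is `η > 0` such
that for every symmetric B-DMC `W` with `δ < I(W) < 1 - δ` and every `k ≥ 2`,
`I(W^k) - I(W) > η`, where `W^k(y_1^k | x) = ∏_j W(y_j | x)`. -/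
theorem stmt12 (δ : ℝ) (hδ : 0 < δ) :
    ∃ η : ℝ, 0 < η ∧
      ∀ (Y : Type) [Fintype Y] (W : ZMod 2 → Y → ℝ),
        IsBDMC W → IsSymmetricBDMC W →
        δ < chanI W → chanI W < 1 - δ →
        ∀ k : ℕ, 2 ≤ k →
          η < chanI (fun b (y : Fin k → Y) => ∏ t, W b (y t)) - chanI W := by
  have hlog : 0 < log 2 := log_pos one_lt_two
  obtain ⟨C, hC₀, hC⟩ := exists_log_two_sub_bscCapacity_le (ε := δ * log 2 / 2) (by positivity)
  refine ⟨δ * (δ * log 2 / 2 / C), by positivity, fun Y _ W hW hS hlo hhi k hk => ?_⟩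
  have hstep (k : ℕ) := chanI_mul_le_chanI_chanProd_sub hW hS (hW.pow k)
  simp only [← chanI_pow_succ] at hstep
  induction k, hk using Nat.le_induction with
  | base =>
    refine lt_of_lt_of_le ?_ (chanI_pow_one W ▸ hstep 1)
    have hres := log_two_mul_one_sub_chanI_le (hW.pow 1) hC
    rw [chanI_pow_one] at hres
    have hgap : δ * log 2 < (1 - chanI W) * log 2 :=
      mul_lt_mul_of_pos_right (by linarith) hlog
    refine mul_lt_mul'' hlo ?_ hδ.le (by positivity)
    rw [div_lt_iff₀ hC₀]
    linarith
  | succ k hk ih =>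
    have hnonneg := mul_nonneg (hδ.trans hlo).le
      (sub_nonneg.mpr (chanAbsBias_le_one (hW.pow k)))
    linarith [hstep k]
end

section
/- Let W be a symmetric B-DMC with Bhattacharyya parameter Z(W), and let P_e(W) = (1/2) ∑_{y∈𝒴} min{W(y|0), W(y|1)} be the bit error probability of uncoded transmission over W under MAP decoding with uniform prior. Then P_e(W) ≥ (1/2)(1 − √(1 − Z(W)²)). -/
/-- Cauchy–Schwarz for the Bhattacharyya coefficient, with each product `f i * g i` split as
`min (f i) (g i) * max (f i) (g i)`. -/
theorem sq_sum_sqrt_mul_le_sum_min_mul_sum_max {ι : Type*} (s : Finset ι) (f g : ι → ℝ)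
    (hf : ∀ i ∈ s, 0 ≤ f i) (hg : ∀ i ∈ s, 0 ≤ g i) :
    (∑ i ∈ s, Real.sqrt (f i * g i)) ^ 2 ≤
      (∑ i ∈ s, min (f i) (g i)) * ∑ i ∈ s, max (f i) (g i) := by
  refine Finset.sum_sq_le_sum_mul_sum_of_sq_le_mul s
    (fun i hi => le_min (hf i hi) (hg i hi)) (fun i hi => le_max_of_le_left (hf i hi))
    (fun i hi => ?_)
  rw [Real.sq_sqrt (mul_nonneg (hf i hi) (hg i hi)), min_mul_max]

/-- For a symmetric B-DMC `W`, the MAP bit error probability of uncoded transmission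
with uniform prior, `P_e(W) = (1/2) ∑_y min{W(y|0), W(y|1)}`, satisfies
`P_e(W) ≥ (1/2)(1 - √(1 - Z(W)²))`. -/
theorem stmt13 {Y : Type} [Fintype Y] (W : ZMod 2 → Y → ℝ)
    (hW : IsBDMC W) (hsym : IsSymmetricBDMC W) :
    (1/2 : ℝ) * (1 - Real.sqrt (1 - chanZ W ^ 2)) ≤ (1/2 : ℝ) * ∑ y, min (W 0 y) (W 1 y) := by
  obtain ⟨hnonneg, hsum⟩ := hW
  have hcs : chanZ W ^ 2 ≤ (∑ y, min (W 0 y) (W 1 y)) * ∑ y, max (W 0 y) (W 1 y) :=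
    sq_sum_sqrt_mul_le_sum_min_mul_sum_max Finset.univ (W 0) (W 1)
      (fun y _ => hnonneg 0 y) (fun y _ => hnonneg 1 y)
  have hadd : ∑ y, min (W 0 y) (W 1 y) + ∑ y, max (W 0 y) (W 1 y) = 2 := by
    simp_rw [← Finset.sum_add_distrib, min_add_max, Finset.sum_add_distrib, hsum]
    norm_num
  have hsqrt : 1 - ∑ y, min (W 0 y) (W 1 y) ≤ Real.sqrt (1 - chanZ W ^ 2) := by
    apply Real.le_sqrt_of_sq_le
    rw [eq_sub_of_add_eq' hadd] at hcs
    linarith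
  linarith
end

section
/- There exists an invertible 16×16 matrix G over GF(2) whose partial distances D_1,…,D_16 satisfy ∏_{i=1}^{16} D_i = 2³⁰ · 3² (= 9663676416); consequently E(G) = (30 + 2·log₂3)/64 ≈ 0.51828 > 1/2, and hence E_16 > 1/2. -/
/-- The first `ℓ` binary digits of `n`, as a vector over GF(2). -/
def bitVec (ℓ n : ℕ) : Fin ℓ → ZMod 2 := fun j => if n.testBit j then 1 else 0

/-- The number of ones among the first `ℓ` binary digits of `n`. -/
def bitWeight : ℕ → ℕ → ℕ
  | 0, _ => 0
  | ℓ + 1, n => bitWeight ℓ n + (n.testBit ℓ).toNat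

/-- Whether every element of the coset of `bitVec ℓ g` modulo the span of the vectors
`bitVec ℓ a`, `a ∈ l`, has Hamming weight at least `d`. -/
def cosetWeightGe (ℓ d : ℕ) : List ℕ → ℕ → Bool
  | [], g => d.ble (bitWeight ℓ g)
  | a :: l, g => cosetWeightGe ℓ d l g && cosetWeightGe ℓ d l (g ^^^ a)

theorem bitVec_xor (ℓ m n : ℕ) : bitVec ℓ (m ^^^ n) = bitVec ℓ m + bitVec ℓ n := by
  funext j
  simp only [bitVec, Nat.testBit_xor, Pi.add_apply]
  cases m.testBit j <;> cases n.testBit j <;> decide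

theorem bitWeight_eq_sum (ℓ n : ℕ) :
    bitWeight ℓ n = ∑ j ∈ Finset.range ℓ, (n.testBit j).toNat := by
  induction ℓ with
  | zero => rfl
  | succ ℓ ih => rw [Finset.sum_range_succ, ← ih, bitWeight]

theorem hammingNorm_bitVec (ℓ n : ℕ) : hammingNorm (bitVec ℓ n) = bitWeight ℓ n := by
  rw [bitWeight_eq_sum, ← Fin.sum_univ_eq_sum_range fun j => (n.testBit j).toNat, hammingNorm,
    Finset.card_filter]
  refine Finset.sum_congr rfl fun j _ => ?_
  simp only [bitVec]
  by_cases h : n.testBit j = true <;> simp [h]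

theorem le_hammingDist_of_cosetWeightGe {ℓ d : ℕ} (l : List ℕ) (g : ℕ)
    (h : cosetWeightGe ℓ d l g = true) (c : Fin ℓ → ZMod 2)
    (hc : c ∈ Submodule.span (ZMod 2) {v | ∃ a ∈ l, v = bitVec ℓ a}) :
    d ≤ hammingDist (bitVec ℓ g) c := by
  induction l generalizing g c with
  | nil =>
    have hc0 : c = 0 := by simpa using hc
    rw [hc0, hammingDist_zero_right, hammingNorm_bitVec]
    exact Nat.le_of_ble_eq_true h
  | cons a l ih =>
    have hset : {v | ∃ b ∈ a :: l, v = bitVec ℓ b} =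
        insert (bitVec ℓ a) {v | ∃ b ∈ l, v = bitVec ℓ b} := by
      ext v
      simp
    rw [hset, Submodule.mem_span_insert] at hc
    obtain ⟨t, z, hz, rfl⟩ := hc
    rw [cosetWeightGe, Bool.and_eq_true] at h
    obtain rfl | rfl : t = 0 ∨ t = 1 := by
      revert t
      decide
    · simpa using ih g h.1 z hz
    · have hdist := ih (g ^^^ a) h.2 z hz
      rw [hammingDist_eq_hammingNorm] at hdist ⊢
      rw [bitVec_xor] at hdist
      convert hdist using 2
      rw [one_smul, neg_add, ZModModule.neg_eq_self (bitVec ℓ a), add_assoc]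

/-- The matrix over GF(2) whose rows are the binary expansions of the entries of a list. -/
def bitMatrix (ℓ : ℕ) (l : List ℕ) : Matrix (Fin ℓ) (Fin ℓ) (ZMod 2) :=
  fun i => bitVec ℓ (l.getD i 0)

theorem partialDist_eq_hammingNorm {ℓ : ℕ} {G : Matrix (Fin ℓ) (Fin ℓ) (ZMod 2)} {i : Fin ℓ}
    (h : ∀ c ∈ Submodule.span (ZMod 2) {v : Fin ℓ → ZMod 2 | ∃ j, i < j ∧ v = G j},
      hammingNorm (G i) ≤ hammingDist (G i) c) :
    partialDist G i = hammingNorm (G i) := by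
  refine IsLeast.csInf_eq ⟨⟨0, Submodule.zero_mem _, (hammingDist_zero_right _).symm⟩, ?_⟩
  rintro d ⟨c, hc, rfl⟩
  exact h c hc

theorem partialDist_bitMatrix {ℓ : ℕ} {l : List ℕ} (hl : l.length = ℓ) (i : Fin ℓ)
    (h : cosetWeightGe ℓ (bitWeight ℓ (l.getD i 0)) (l.drop (i + 1)) (l.getD i 0) = true) :
    partialDist (bitMatrix ℓ l) i = hammingNorm (bitMatrix ℓ l i) := by
  refine partialDist_eq_hammingNorm fun c hc => ?_
  rw [bitMatrix, hammingNorm_bitVec]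
  refine le_hammingDist_of_cosetWeightGe _ _ h c (Submodule.span_mono ?_ hc)
  rintro v ⟨j, hij, rfl⟩
  refine ⟨l.getD j 0, ?_, rfl⟩
  have hj : (j : ℕ) < l.length := hl ▸ j.isLt
  have hij' : (i : ℕ) < j := hij
  rw [List.getD_eq_getElem _ _ hj, List.mem_drop_iff_getElem]
  exact ⟨j - (i + 1), by omega, by congr 1; omega⟩

theorem hammingDist_pos_of_isUnit {ℓ : ℕ} {G : Matrix (Fin ℓ) (Fin ℓ) (ZMod 2)} (hG : IsUnit G)
    {i : Fin ℓ} {c : Fin ℓ → ZMod 2}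
    (hc : c ∈ Submodule.span (ZMod 2) {v : Fin ℓ → ZMod 2 | ∃ j, i < j ∧ v = G j}) :
    0 < hammingDist (G i) c := by
  rw [hammingDist_pos]
  rintro rfl
  have hset : {v : Fin ℓ → ZMod 2 | ∃ j, i < j ∧ v = G j} = G.row '' Set.Ioi i := by
    ext v
    exact exists_congr fun j => and_congr_right fun _ => eq_comm
  rw [hset] at hc
  exact (Matrix.linearIndependent_rows_iff_isUnit.mpr hG).notMem_span_image
    (s := Set.Ioi i) (x := i) (by simp) hc

theorem natCast_hammingNorm {ι : Type*} [Fintype ι] (v : ι → ZMod 2) :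
    (hammingNorm v : ZMod 2) = ∑ j, v j := by
  have h : ∀ t : ZMod 2, (if t ≠ 0 then 1 else 0) = t := by decide
  rw [hammingNorm, Finset.natCast_card_filter]
  exact Finset.sum_congr rfl fun j _ => h (v j)

theorem even_hammingDist {ι : Type*} [Fintype ι] {S : Set (ι → ZMod 2)} {v c : ι → ZMod 2}
    (hv : Even (hammingNorm v)) (hS : ∀ w ∈ S, Even (hammingNorm w))
    (hc : c ∈ Submodule.span (ZMod 2) S) : Even (hammingDist v c) := by
  simp only [← ZMod.natCast_eq_zero_iff_even, natCast_hammingNorm] at hv hS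
  have hc0 : ∑ j, c j = 0 := by
    induction hc using Submodule.span_induction with
    | mem w hw => exact hS w hw
    | zero => simp
    | add x y _ _ hx hy => simp [Finset.sum_add_distrib, hx, hy]
    | smul t x _ hx => simp [← Finset.mul_sum, hx]
  rw [← ZMod.natCast_eq_zero_iff_even, hammingDist_eq_hammingNorm, natCast_hammingNorm]
  simp [Finset.sum_add_distrib, hv, hc0]

theorem bddAbove_expE (ℓ : ℕ) :
    BddAbove {x : ℝ | ∃ G : Matrix (Fin ℓ) (Fin ℓ) (ZMod 2), IsUnit G ∧ x = expE G} := by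
  refine ((Set.finite_range (expE (ℓ := ℓ))).subset ?_).bddAbove
  rintro x ⟨G, -, rfl⟩
  exact ⟨G, rfl⟩

theorem expE_eq_logb_prod {ℓ : ℕ} (G : Matrix (Fin ℓ) (Fin ℓ) (ZMod 2))
    (h : ∏ i, partialDist G i ≠ 0) :
    expE G = (1 / ℓ : ℝ) * Real.logb ℓ ((∏ i, partialDist G i : ℕ) : ℝ) := by
  rw [expE, Nat.cast_prod, Real.logb_prod]
  intro i hi
  exact_mod_cast Finset.prod_ne_zero_iff.mp h i hi

/-- Rows of a basis of GF(2)¹⁶ adapted to the chain of extended BCH codes of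
dimensions 1, 5, 7, 11, the even-weight code, and the whole space. -/
def bchRows : List ℕ :=
  [1, 24, 12, 6, 3, 278, 139, 106, 53, 1254, 627, 18348, 9174, 4587, 3929, 65535]

/-- Rows of the inverse of the matrix with rows `bchRows`. -/
def bchInverseRows : List ℕ :=
  [1, 17, 25, 29, 31, 263, 395, 77, 55, 1155, 713, 18421, 8443, 5477, 3891, 64495]

theorem isUnit_bitMatrix_bchRows : IsUnit (bitMatrix 16 bchRows) := by
  have h : bitMatrix 16 bchRows * bitMatrix 16 bchInverseRows = 1 := by
    decide +kernel
  exact IsUnit.of_mul_eq_one _ h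

theorem even_hammingNorm_bchRows (i : Fin 16) (hi : i ≠ 0) :
    Even (hammingNorm (bitMatrix 16 bchRows i)) := by
  revert i
  simp only [bitMatrix, hammingNorm_bitVec]
  decide +kernel

theorem hammingNorm_bchRows_le_two (i : Fin 16) (hi : i < 5) :
    hammingNorm (bitMatrix 16 bchRows i) ≤ 2 := by
  revert i
  simp only [bitMatrix, hammingNorm_bitVec]
  decide +kernel

theorem hammingNorm_bchRows_zero : hammingNorm (bitMatrix 16 bchRows 0) = 1 := by
  rw [bitMatrix, hammingNorm_bitVec]
  decide +kernel

theorem partialDist_bchRows (i : Fin 16) :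
    partialDist (bitMatrix 16 bchRows) i = hammingNorm (bitMatrix 16 bchRows i) := by
  by_cases hi : i < 5
  · refine partialDist_eq_hammingNorm fun c hc => ?_
    have hpos := hammingDist_pos_of_isUnit isUnit_bitMatrix_bchRows hc
    by_cases hi0 : i = 0
    · subst hi0
      rwa [hammingNorm_bchRows_zero]
    · refine (hammingNorm_bchRows_le_two i hi).trans ?_
      have heven : Even (hammingDist (bitMatrix 16 bchRows i) c) := by
        refine even_hammingDist (even_hammingNorm_bchRows i hi0) ?_ hc
        rintro w ⟨j, hij, rfl⟩
        exact even_hammingNorm_bchRows j (Fin.ne_zero_of_lt hij)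
      exact Nat.le_of_dvd hpos heven.two_dvd
  · refine partialDist_bitMatrix (l := bchRows) (ℓ := 16) rfl i ?_
    revert i
    decide +kernel

theorem prod_partialDist_bchRows :
    ∏ i, partialDist (bitMatrix 16 bchRows) i = 2 ^ 30 * 3 ^ 2 := by
  simp only [partialDist_bchRows, bitMatrix, hammingNorm_bitVec]
  decide +kernel

theorem expE_bchRows : expE (bitMatrix 16 bchRows) = (30 + 2 * Real.logb 2 3) / 64 := by
  have hlog : Real.log 16 = 4 * Real.log 2 := by
    rw [show (16 : ℝ) = 2 ^ 4 by norm_num, Real.log_pow]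
    norm_num
  have hpos : Real.log 2 ≠ 0 := (Real.log_pos one_lt_two).ne'
  rw [expE_eq_logb_prod _ (by rw [prod_partialDist_bchRows]; norm_num),
    prod_partialDist_bchRows]
  simp only [Nat.cast_mul, Nat.cast_pow, Nat.cast_ofNat]
  rw [Real.logb, Real.logb, Real.log_mul (by positivity) (by positivity), Real.log_pow,
    Real.log_pow, hlog]
  push_cast
  field_simp
  ring

theorem half_lt_expE_bchRows : (1 / 2 : ℝ) < expE (bitMatrix 16 bchRows) := by
  have h : (1 : ℝ) < Real.logb 2 3 := by
    rw [Real.lt_logb_iff_rpow_lt one_lt_two (by norm_num)]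
    norm_num
  rw [expE_bchRows]
  linarith

/-- There is an invertible `16×16` matrix `G` over GF(2) with
`∏_{i=1}^{16} D_i = 2³⁰·3² = 9663676416`, hence
`E(G) = (30 + 2 log₂ 3)/64 > 1/2`, and therefore `E₁₆ > 1/2`. -/
theorem stmt15 :
    (∃ G : Matrix (Fin 16) (Fin 16) (ZMod 2), IsUnit G ∧
        (∏ i, partialDist G i) = 2 ^ 30 * 3 ^ 2 ∧
        expE G = (30 + 2 * Real.logb 2 3) / 64 ∧
        (1/2 : ℝ) < expE G) ∧
      (1/2 : ℝ) < Emax 16 := by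
  refine ⟨⟨bitMatrix 16 bchRows, isUnit_bitMatrix_bchRows, prod_partialDist_bchRows,
    expE_bchRows, half_lt_expE_bchRows⟩, half_lt_expE_bchRows.trans_le ?_⟩
  exact le_csSup (bddAbove_expE 16) ⟨_, isUnit_bitMatrix_bchRows, rfl⟩
end
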